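/- Let S be an invariant subspace of finite codimension in H²(𝔻ⁿ). If S is doubly commuting, i.e., R_i* R_j = R_j R_i* for all i ≠ j, then S = H²(𝔻ⁿ). Equivalently, every proper invariant subspace of finite codimension in H²(𝔻ⁿ) satisfies R_i* R_j ≠ R_j R_i* for some pair i ≠ j. -/

import Mathlib

open ContinuousLinearMap

/-- The `C^*`-algebra generated by a set `R` of operators on a Hilbert space `E`:
the operator-norm closure of the star subalgebra generated by `R`. -/
noncomputable def genCStar {E : Type*} [NormedAddCommGroup E] [InnerProductSpace ℂ E]
    [CompleteSpace E] (R : Set (E →L[ℂ] E)) : Set (E →L[ℂ] E) :=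
  ((StarAlgebra.adjoin ℂ R).topologicalClosure : Set (E →L[ℂ] E))

/-- The Hardy space `H²(𝔻ⁿ)` realized as `ℓ²` over multi-indices `Fin n → ℕ`. -/
abbrev PolyHardy (n : ℕ) : Type := lp (fun _ : Fin n → ℕ => ℂ) 2

/-- The compression `P_S T|_S` of an operator `T` on `H²(𝔻ⁿ)` to a closed subspace `S`. -/
noncomputable def compressS {n : ℕ} (S : Submodule ℂ (PolyHardy n))
    (hS : IsClosed (S : Set (PolyHardy n))) (T : PolyHardy n →L[ℂ] PolyHardy n) :
    ↥S →L[ℂ] ↥S :=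
  haveI : CompleteSpace ↥S := hS.completeSpace_coe
  S.orthogonalProjectionOnto ∘L (T ∘L S.subtypeL)

/-- The restriction `T|_S : S → S` of an operator `T` leaving `S` invariant. -/
noncomputable def restrictS {n : ℕ} (S : Submodule ℂ (PolyHardy n))
    (T : PolyHardy n →L[ℂ] PolyHardy n) (h : ∀ x ∈ S, T x ∈ S) : ↥S →L[ℂ] ↥S :=
  ContinuousLinearMap.codRestrict (T ∘L S.subtypeL) S fun x => h x x.2

/-- The orthogonal projection of `H²(𝔻ⁿ)` onto a closed subspace `S`, as an operator on
`H²(𝔻ⁿ)`. -/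
noncomputable def projFull {n : ℕ} (S : Submodule ℂ (PolyHardy n))
    (hS : IsClosed (S : Set (PolyHardy n))) : PolyHardy n →L[ℂ] PolyHardy n :=
  haveI : CompleteSpace ↥S := hS.completeSpace_coe
  S.subtypeL ∘L S.orthogonalProjectionOnto

/-- The adjoint of an operator on a closed subspace `S` of `H²(𝔻ⁿ)`. -/
noncomputable def adjS {n : ℕ} (S : Submodule ℂ (PolyHardy n))
    (hS : IsClosed (S : Set (PolyHardy n))) (T : ↥S →L[ℂ] ↥S) : ↥S →L[ℂ] ↥S :=
  haveI : CompleteSpace ↥S := hS.completeSpace_coe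
  ContinuousLinearMap.adjoint T

/-- The `C^*`-algebra `T(S) ⊆ B(S)` generated by operators `R i` on a closed subspace `S`. -/
noncomputable def TalgGen {n : ℕ} (S : Submodule ℂ (PolyHardy n))
    (hS : IsClosed (S : Set (PolyHardy n))) (R : Fin n → (↥S →L[ℂ] ↥S)) :
    Set (↥S →L[ℂ] ↥S) :=
  haveI : CompleteSpace ↥S := hS.completeSpace_coe
  genCStar (Set.range R)

/-- The `C^*`-algebra `T(H²(𝔻ⁿ))` generated by the coordinate shifts. -/
noncomputable def TalgFull {n : ℕ} (Mz : Fin n → (PolyHardy n →L[ℂ] PolyHardy n)) :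
    Set (PolyHardy n →L[ℂ] PolyHardy n) :=
  genCStar (Set.range Mz)

/-- An operator without eigenvectors has no nonzero finite-dimensional invariant subspace. -/
theorem eq_bot_of_finiteDimensional_of_mapsTo {E : Type*} [AddCommGroup E] [Module ℂ E]
    (T : E →ₗ[ℂ] E) (hT : ∀ (μ : ℂ) (f : E), T f = μ • f → f = 0)
    (V : Submodule ℂ E) [FiniteDimensional ℂ V] (hV : ∀ x ∈ V, T x ∈ V) : V = ⊥ := by
  by_contra hne
  have : Nontrivial V := Submodule.nontrivial_iff_ne_bot.mpr hne
  obtain ⟨μ, hμ⟩ := Module.End.exists_eigenvalue (T.restrict hV)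
  obtain ⟨v, hv⟩ := hμ.exists_hasEigenvector
  refine hv.2 (Subtype.ext (hT μ v ?_))
  simpa using congrArg Subtype.val hv.apply_eq_smul

section CoordinateShift

variable {n : ℕ} {i : Fin n} {T : PolyHardy n →L[ℂ] PolyHardy n}

theorem coordShift_no_eigenvector
    (hT : ∀ (f : PolyHardy n) (k : Fin n → ℕ),
      T f k = if k i = 0 then 0 else f (Function.update k i (k i - 1)))
    (μ : ℂ) (f : PolyHardy n) (h : T f = μ • f) : f = 0 := by
  have key (k : Fin n → ℕ) : T f k = μ * f k := by rw [h]; rfl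
  by_cases hμ : μ = 0
  · ext k
    have h1 := key (Function.update k i (k i + 1))
    rw [hT] at h1
    simpa [hμ] using h1
  · have main (m : ℕ) : ∀ k : Fin n → ℕ, k i = m → f k = 0 := by
      induction m with
      | zero =>
        intro k hk
        have h1 := key k
        rw [hT, if_pos hk] at h1
        simpa [hμ] using h1.symm
      | succ m ih =>
        intro k hk
        have h1 := key k
        rw [hT, if_neg (by lia), ih _ (by simp [hk])] at h1
        simpa [hμ] using h1.symm
    ext k
    exact main _ k rfl

theorem adjoint_coordShift_apply
    (hT : ∀ (f : PolyHardy n) (k : Fin n → ℕ),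
      T f k = if k i = 0 then 0 else f (Function.update k i (k i - 1)))
    (f : PolyHardy n) (k : Fin n → ℕ) :
    adjoint T f k = f (Function.update k i (k i + 1)) := by
  have h1 (k : Fin n → ℕ) (g : PolyHardy n) : g k = inner ℂ (lp.single 2 k (1 : ℂ)) g := by
    simp [lp.inner_single_left]
  have h2 : T (lp.single 2 k (1 : ℂ)) = lp.single 2 (Function.update k i (k i + 1)) (1 : ℂ) := by
    ext m
    rw [hT]
    simp only [lp.single_apply, Pi.single_apply]
    by_cases hm : m i = 0
    · rw [if_pos hm, if_neg]
      rintro rfl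
      simp at hm
    · rw [if_neg hm]
      congr 1
      refine propext ⟨?_, ?_⟩
      · rintro rfl
        simp [Nat.sub_add_cancel (Nat.pos_of_ne_zero hm)]
      · rintro rfl
        simp
  rw [h1, adjoint_inner_right, h2, ← h1]

theorem adjoint_coordShift_comm {j : Fin n} (hij : i ≠ j) {U : PolyHardy n →L[ℂ] PolyHardy n}
    (hT : ∀ (f : PolyHardy n) (k : Fin n → ℕ),
      T f k = if k i = 0 then 0 else f (Function.update k i (k i - 1)))
    (hU : ∀ (f : PolyHardy n) (k : Fin n → ℕ),
      U f k = if k j = 0 then 0 else f (Function.update k j (k j - 1)))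
    (f : PolyHardy n) : adjoint T (U f) = U (adjoint T f) := by
  ext k
  rw [adjoint_coordShift_apply hT, hU, hU, adjoint_coordShift_apply hT]
  simp [hij, hij.symm, Function.update_comm hij]

end CoordinateShift

/-- Every doubly commuting invariant subspace of finite codimension in `H²(𝔻ⁿ)` is the whole
space: if `R_i^* R_j = R_j R_i^*` for all `i ≠ j`, then `S = H²(𝔻ⁿ)`. -/
theorem stmt14 {n : ℕ} (hn : 2 ≤ n)
    (Mz : Fin n → (PolyHardy n →L[ℂ] PolyHardy n))
    (hMz : ∀ (i : Fin n) (f : PolyHardy n) (k : Fin n → ℕ),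
      Mz i f k = if k i = 0 then 0 else f (Function.update k i (k i - 1)))
    (S : Submodule ℂ (PolyHardy n)) (hS : IsClosed (S : Set (PolyHardy n)))
    (hinv : ∀ (i : Fin n), ∀ x ∈ S, Mz i x ∈ S)
    (hcodim : FiniteDimensional ℂ ↥Sᗮ)
    (hdc : ∀ i j : Fin n, i ≠ j →
      adjS S hS (compressS S hS (Mz i)) ∘L compressS S hS (Mz j)
        = compressS S hS (Mz j) ∘L adjS S hS (compressS S hS (Mz i))) :
    S = ⊤ := by
  have : CompleteSpace S := hS.completeSpace_coe
  let a : Fin n := ⟨0, by lia⟩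
  let b : Fin n := ⟨1, by lia⟩
  have hab : a ≠ b := by simp [a, b]
  let A := adjoint (Mz a)
  have hadj (s : S) : (adjS S hS (compressS S hS (Mz a)) s : PolyHardy n)
      = S.starProjection (A s) := by
    have h : adjS S hS (compressS S hS (Mz a)) s = S.orthogonalProjectionOnto (A s) := by
      refine ext_inner_left ℂ fun v => ?_
      simp only [adjS, compressS, adjoint_inner_right, coe_comp, Function.comp_apply,
        Submodule.subtypeL_apply, A]
      rw [Submodule.inner_orthogonalProjectionOnto_eq_of_mem_left,
        Submodule.inner_orthogonalProjectionOnto_eq_of_mem_right, adjoint_inner_right]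
    rw [h]; rfl
  have hcomp (j : Fin n) (s : S) : (compressS S hS (Mz j) s : PolyHardy n) = Mz j s :=
    Submodule.starProjection_eq_self_iff.mpr (hinv j s s.2)
  have hcomm (s : S) :
      S.starProjection (A (Mz b s)) = Mz b (S.starProjection (A s)) := by
    have h := congrArg Subtype.val (DFunLike.congr_fun (hdc a b hab) s)
    simp only [coe_comp, Function.comp_apply] at h
    rwa [hadj, hcomp, hcomp, hadj] at h
  let C : PolyHardy n →ₗ[ℂ] PolyHardy n :=
    (ContinuousLinearMap.id ℂ _ - S.starProjection).toLinearMap ∘ₗ A.toLinearMap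
  have hC (x : PolyHardy n) : C x = A x - S.starProjection (A x) := rfl
  have hle : S.map C ≤ Sᗮ := by
    rintro _ ⟨x, -, rfl⟩
    exact S.sub_starProjection_mem_orthogonal (A x)
  have : FiniteDimensional ℂ (S.map C) := Submodule.finiteDimensional_of_le hle
  have hbot : S.map C = ⊥ := by
    refine eq_bot_of_finiteDimensional_of_mapsTo (Mz b).toLinearMap
      (coordShift_no_eigenvector (hMz b)) _ ?_
    rintro _ ⟨x, hx, rfl⟩
    refine ⟨Mz b x, hinv b x hx, ?_⟩
    have h := hcomm ⟨x, hx⟩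
    have h' : A (Mz b x) = Mz b (A x) := adjoint_coordShift_comm hab (hMz a) (hMz b) x
    change C (Mz b x) = Mz b (C x)
    rw [hC, hC, map_sub, h, h']
  have hAS (x : PolyHardy n) (hx : x ∈ S) : A x ∈ S := by
    have h : C x ∈ S.map C := ⟨x, hx, rfl⟩
    rw [hbot, Submodule.mem_bot, hC, sub_eq_zero] at h
    rw [h]
    exact S.starProjection_apply_mem _
  rw [← Submodule.orthogonal_eq_bot_iff]
  refine eq_bot_of_finiteDimensional_of_mapsTo (Mz a).toLinearMap
    (coordShift_no_eigenvector (hMz a)) _ fun q hq => ?_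
  rw [Submodule.mem_orthogonal] at hq ⊢
  intro u hu
  have h := hq _ (hAS u hu)
  rwa [adjoint_inner_left] at h
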